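/- Let Γ be a smooth solution of the Yang–Mills flow on ℝⁿ × [0,T) such that there is a compact set K ⊂ ℝⁿ with supp Γ_t ⊆ K for every t, and let z₀ = (x₀,t₀) with t₀ ∈ (0,T). Then R ↦ Φ_{z₀}(R;Γ) is differentiable on (0, √t₀/2) and for every R in that interval, (d/dR) Φ_{z₀}(R;Γ) = R⁵ ∫_{ℝⁿ} | R^{−2}(x−x₀) ⌟ F_{t₀−R²}(x) + 2 (D*F)_{t₀−R²}(x) |² G_{z₀}(x, t₀−R²) dx, where | · |² is computed summing Σ_{j=1}^n of the matrix norms squared of the components. -/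

import Mathlib

open MeasureTheory Filter Set
open scoped ContDiff ENNReal

noncomputable section

abbrev Mat (k : ℕ) := Fin k → Fin k → ℝ

def mmul {k : ℕ} (A B : Mat k) : Mat k := fun i j => ∑ l, A i l * B l j

def mbra {k : ℕ} (A B : Mat k) : Mat k := mmul A B - mmul B A

def minner {k : ℕ} (A B : Mat k) : ℝ := ∑ i, ∑ j, A i j * B i j

def msq {k : ℕ} (A : Mat k) : ℝ := minner A A

abbrev Conn (n k : ℕ) := ℝ → (Fin n → ℝ) → Fin n → Mat k

/-- Spatial partial derivative in the `i`-th coordinate direction. -/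
def pd {n : ℕ} {E : Type*} [NormedAddCommGroup E] [NormedSpace ℝ E]
    (f : (Fin n → ℝ) → E) (x : Fin n → ℝ) (i : Fin n) : E :=
  fderiv ℝ f x (Pi.single i 1)

/-- Time derivative of a time-dependent connection. -/
def tderiv {n k : ℕ} (Γ : Conn n k) (t : ℝ) (x : Fin n → ℝ) (j : Fin n) : Mat k :=
  deriv (fun s => Γ s x j) t

/-- Curvature `(F_t)_{ij} = ∂_i(Γ_t)_j − ∂_j(Γ_t)_i + [(Γ_t)_i,(Γ_t)_j]`. -/
def curv {n k : ℕ} (Γ : Conn n k) (t : ℝ) (x : Fin n → ℝ) (i j : Fin n) : Mat k :=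
  pd (fun y => Γ t y j) x i - pd (fun y => Γ t y i) x j + mbra (Γ t x i) (Γ t x j)

/-- Covariant derivative `∇_i om = ∂_i om + [(Γ_t)_i, om]`. -/
def covD {n k : ℕ} (Γ : Conn n k) (t : ℝ) (om : (Fin n → ℝ) → Mat k)
    (x : Fin n → ℝ) (i : Fin n) : Mat k :=
  pd om x i + mbra (Γ t x i) (om x)

/-- A smooth time-dependent connection: jointly smooth in `(t,x)`, with values in the
skew-symmetric matrices `𝔤`. -/
def IsSmoothConn {n k : ℕ} (Γ : Conn n k) : Prop :=
  ContDiff ℝ ∞ (fun p : ℝ × (Fin n → ℝ) => Γ p.1 p.2)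
    ∧ ∀ t x i a b, Γ t x i b a = - (Γ t x i a b)

/-- The Yang–Mills flow equation `∂_t(Γ_t)_j = Σᵢ ∇_i(F_t)_{ij}` on a time interval `I`. -/
def IsYMFlowOn {n k : ℕ} (Γ : Conn n k) (I : Set ℝ) : Prop :=
  ∀ t ∈ I, ∀ x j, tderiv Γ t x j = ∑ i, covD Γ t (fun y => curv Γ t y i j) x i

/-- `|F_t|²(x) = Σ_{i,j} |(F_t)_{ij}(x)|²`. -/
def normF2 {n k : ℕ} (Γ : Conn n k) (t : ℝ) (x : Fin n → ℝ) : ℝ :=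
  ∑ i, ∑ j, msq (curv Γ t x i j)

/-- The backwards heat kernel `G_{z₀}(x,t)` based at `z₀ = (x₀,t₀)`. -/
def gauss {n : ℕ} (z0 : (Fin n → ℝ) × ℝ) (x : Fin n → ℝ) (t : ℝ) : ℝ :=
  (4 * Real.pi * (z0.2 - t)) ^ (-(n : ℝ) / 2) *
    Real.exp (-(∑ i, (x i - z0.1 i) ^ 2) / (4 * (z0.2 - t)))

/-- The entropy `Φ_{z₀}(R;Γ)`. -/
def Phi {n k : ℕ} (Γ : Conn n k) (z0 : (Fin n → ℝ) × ℝ) (R : ℝ) : ℝ :=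
  R ^ 4 / 2 * ∫ x : Fin n → ℝ, normF2 Γ (z0.2 - R ^ 2) x * gauss z0 x (z0.2 - R ^ 2)

/-- The entropy `Ψ_{z₀}(R;Γ)`. -/
def Psi {n k : ℕ} (Γ : Conn n k) (z0 : (Fin n → ℝ) × ℝ) (R : ℝ) : ℝ :=
  R ^ 2 / 2 * ∫ t in Icc (z0.2 - 4 * R ^ 2) (z0.2 - R ^ 2),
    ∫ x : Fin n → ℝ, normF2 Γ t x * gauss z0 x t

/-- The parabolically rescaled connection `Γ^{λ,z₀}`. -/
def rescale {n k : ℕ} (Γ : Conn n k) (z0 : (Fin n → ℝ) × ℝ) (lam : ℝ) : Conn n k :=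
  fun t x i => lam • Γ (lam ^ 2 * t + z0.2) (fun m => lam * x m + z0.1 m) i

/-- Spatial support of `Γ_t` contained in `K` for all `t`. -/
def SuppIn {n k : ℕ} (Γ : Conn n k) (K : Set (Fin n → ℝ)) : Prop :=
  ∀ t x, x ∉ K → Γ t x = 0

/-- `(D*F)_j = −Σᵢ ∇ᵢ F_{ij}`. -/
def dstarF {n k : ℕ} (Γ : Conn n k) (t : ℝ) (x : Fin n → ℝ) (j : Fin n) : Mat k :=
  -∑ i, covD Γ t (fun y => curv Γ t y i j) x i

section Algebra

variable {k : ℕ}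

lemma mmul_assoc (A B C : Mat k) : mmul (mmul A B) C = mmul A (mmul B C) :=
  Matrix.mul_assoc (A : Matrix (Fin k) (Fin k) ℝ) B C

lemma mmul_add (A B C : Mat k) : mmul A (B + C) = mmul A B + mmul A C :=
  Matrix.mul_add (A : Matrix (Fin k) (Fin k) ℝ) B C

lemma add_mmul (A B C : Mat k) : mmul (A + B) C = mmul A C + mmul B C :=
  Matrix.add_mul (A : Matrix (Fin k) (Fin k) ℝ) B C

lemma smul_mmul (c : ℝ) (A B : Mat k) : mmul (c • A) B = c • mmul A B :=
  Matrix.smul_mul c (A : Matrix (Fin k) (Fin k) ℝ) B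

lemma mmul_smul (c : ℝ) (A B : Mat k) : mmul A (c • B) = c • mmul A B :=
  Matrix.mul_smul (A : Matrix (Fin k) (Fin k) ℝ) c B

/-- Matrix multiplication as a continuous bilinear map. -/
def mmulCLM (k : ℕ) : Mat k →L[ℝ] Mat k →L[ℝ] Mat k :=
  (LinearMap.mk₂ ℝ mmul add_mmul smul_mmul mmul_add mmul_smul).toContinuousBilinearMap

lemma mmulCLM_apply (A B : Mat k) : mmulCLM k A B = mmul A B := rfl

/-- The commutator as a continuous bilinear map. -/
def mbraCLM (k : ℕ) : Mat k →L[ℝ] Mat k →L[ℝ] Mat k := mmulCLM k - (mmulCLM k).flip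

lemma mbraCLM_apply (A B : Mat k) : mbraCLM k A B = mbra A B := rfl

lemma mbra_jacobi (A B C : Mat k) :
    mbra A (mbra B C) + mbra B (mbra C A) + mbra C (mbra A B) = 0 := by
  simp only [mbra, ← mmulCLM_apply, map_sub, sub_apply]
  simp only [mmulCLM_apply, mmul_assoc]
  abel

lemma mbra_swap (A B : Mat k) : mbra A B = -mbra B A := by simp [mbra]

/-- The trace inner product as a continuous bilinear map. -/
def minnerCLM (k : ℕ) : Mat k →L[ℝ] Mat k →L[ℝ] ℝ :=
  (LinearMap.mk₂ ℝ minner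
    (fun A B C => by simp [minner, add_mul, Finset.sum_add_distrib])
    (fun c A B => by simp [minner, mul_assoc, Finset.mul_sum])
    (fun A B C => by simp [minner, mul_add, Finset.sum_add_distrib])
    (fun c A B => by simp [minner, mul_left_comm, Finset.mul_sum])).toContinuousBilinearMap

lemma minnerCLM_apply (A B : Mat k) : minnerCLM k A B = minner A B := rfl

lemma minner_comm (A B : Mat k) : minner A B = minner B A := by simp [minner, mul_comm]

lemma minner_mbra {A : Mat k} (hA : ∀ a b, A b a = -A a b) (B C : Mat k) :
    minner (mbra A B) C + minner B (mbra A C) = 0 := by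
  have h1 : minner (mmul A B) C = -minner B (mmul A C) := by
    simp only [minner, mmul, Finset.sum_mul, Finset.mul_sum]
    rw [← Finset.sum_neg_distrib, Finset.sum_comm_cycle]
    refine Finset.sum_congr rfl fun i _ => ?_
    rw [Finset.sum_comm, ← Finset.sum_neg_distrib]
    refine Finset.sum_congr rfl fun j _ => ?_
    rw [← Finset.sum_neg_distrib]
    refine Finset.sum_congr rfl fun l _ => ?_
    rw [hA i l]
    ring
  have h2 : minner (mmul B A) C = -minner B (mmul C A) := by
    simp only [minner, mmul, Finset.sum_mul, Finset.mul_sum]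
    rw [← Finset.sum_neg_distrib]
    refine Finset.sum_congr rfl fun i _ => ?_
    rw [Finset.sum_comm, ← Finset.sum_neg_distrib]
    refine Finset.sum_congr rfl fun j _ => ?_
    rw [← Finset.sum_neg_distrib]
    refine Finset.sum_congr rfl fun l _ => ?_
    rw [hA j l]
    ring
  simp only [mbra, ← minnerCLM_apply, map_sub, sub_apply] at *
  linarith

end Algebra

section DirectionalDerivative

variable {P E E₁ E₂ : Type*} [NormedAddCommGroup P] [NormedSpace ℝ P]
  [NormedAddCommGroup E] [NormedSpace ℝ E] [NormedAddCommGroup E₁] [NormedSpace ℝ E₁]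
  [NormedAddCommGroup E₂] [NormedSpace ℝ E₂]

/-- The directional derivative of `f` at `p` along `v`. -/
def dirD (f : P → E) (v p : P) : E := fderiv ℝ f p v

lemma ContDiff.dirD {f : P → E} (hf : ContDiff ℝ ∞ f) (v : P) : ContDiff ℝ ∞ (dirD f v) :=
  (hf.fderiv_right (by simp)).clm_apply contDiff_const

lemma ContDiff.differentiableAt_of_smooth {f : P → E} (hf : ContDiff ℝ ∞ f) (p : P) :
    DifferentiableAt ℝ f p :=
  (hf.differentiable (by simp)) p

lemma dirD_add {f g : P → E} {p : P} (hf : DifferentiableAt ℝ f p)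
    (hg : DifferentiableAt ℝ g p) (v : P) :
    dirD (fun q => f q + g q) v p = dirD f v p + dirD g v p := by
  simp [dirD, fderiv_fun_add hf hg]

lemma dirD_sub {f g : P → E} {p : P} (hf : DifferentiableAt ℝ f p)
    (hg : DifferentiableAt ℝ g p) (v : P) :
    dirD (fun q => f q - g q) v p = dirD f v p - dirD g v p := by
  simp [dirD, fderiv_fun_sub hf hg]

lemma dirD_sum {ι : Type*} (s : Finset ι) {f : ι → P → E} {p : P}
    (hf : ∀ i ∈ s, DifferentiableAt ℝ (f i) p) (v : P) :
    dirD (fun q => ∑ i ∈ s, f i q) v p = ∑ i ∈ s, dirD (f i) v p := by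
  simp [dirD, fderiv_fun_sum hf]

lemma dirD_bilinear (B : E₁ →L[ℝ] E₂ →L[ℝ] E) {f : P → E₁} {g : P → E₂} {p : P}
    (hf : DifferentiableAt ℝ f p) (hg : DifferentiableAt ℝ g p) (v : P) :
    dirD (fun q => B (f q) (g q)) v p = B (dirD f v p) (g p) + B (f p) (dirD g v p) := by
  simp only [dirD, (B.hasFDerivAt_of_bilinear hf.hasFDerivAt hg.hasFDerivAt).fderiv]
  simp [add_comm]

lemma dirD_smul {c : P → ℝ} {f : P → E} {p : P} (hc : DifferentiableAt ℝ c p)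
    (hf : DifferentiableAt ℝ f p) (v : P) :
    dirD (fun q => c q • f q) v p = dirD c v p • f p + c p • dirD f v p :=
  dirD_bilinear (ContinuousLinearMap.lsmul ℝ ℝ) hc hf v

lemma dirD_comm {f : P → E} (hf : ContDiff ℝ ∞ f) (u v p : P) :
    dirD (dirD f u) v p = dirD (dirD f v) u p := by
  have hd : DifferentiableAt ℝ (fderiv ℝ f) p :=
    (hf.fderiv_right (m := ∞) (by simp)).differentiableAt_of_smooth p
  have key (w z : P) : dirD (dirD f w) z p = fderiv ℝ (fderiv ℝ f) p z w := by
    change fderiv ℝ (fun q => fderiv ℝ f q w) p z = _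
    rw [fderiv_clm_apply hd (differentiableAt_const w)]
    simp
  rw [key, key]
  have h2 : ((2 : ℕ∞) : WithTop ℕ∞) ≤ ((⊤ : ℕ∞) : WithTop ℕ∞) := WithTop.coe_le_coe.2 le_top
  exact (hf.contDiffAt.isSymmSndFDerivAt (by simpa using h2)) v u

lemma dirD_eq_zero {f : P → E} {p : P} (h : f =ᶠ[nhds p] 0) (v : P) : dirD f v p = 0 := by
  rw [dirD, h.fderiv_eq]
  simp

end DirectionalDerivative

section Curvature

variable {P : Type*} [NormedAddCommGroup P] [NormedSpace ℝ P] {k : ℕ}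

/-- The covariant derivative of `f` along `u`, where `a` is the connection component along `u`. -/
def cov (a : P → Mat k) (u : P) (f : P → Mat k) (p : P) : Mat k :=
  dirD f u p + mbra (a p) (f p)

/-- The curvature component along `u`, `v`, where `a`, `b` are the connection components along
`u` and `v`. -/
def fieldStrength (a b : P → Mat k) (u v p : P) : Mat k :=
  dirD b u p - dirD a v p + mbra (a p) (b p)

lemma contDiff_mbra {a b : P → Mat k} (ha : ContDiff ℝ ∞ a) (hb : ContDiff ℝ ∞ b) :
    ContDiff ℝ ∞ fun p => mbra (a p) (b p) :=
  ((mbraCLM k).contDiff.comp ha).clm_apply hb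

lemma contDiff_minner {a b : P → Mat k} (ha : ContDiff ℝ ∞ a) (hb : ContDiff ℝ ∞ b) :
    ContDiff ℝ ∞ fun p => minner (a p) (b p) :=
  ((minnerCLM k).contDiff.comp ha).clm_apply hb

lemma contDiff_fieldStrength {a b : P → Mat k} (ha : ContDiff ℝ ∞ a) (hb : ContDiff ℝ ∞ b)
    (u v : P) : ContDiff ℝ ∞ (fieldStrength a b u v) :=
  ((hb.dirD u).sub (ha.dirD v)).add (contDiff_mbra ha hb)

lemma dirD_mbra {a b : P → Mat k} (ha : ContDiff ℝ ∞ a) (hb : ContDiff ℝ ∞ b) (v p : P) :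
    dirD (fun q => mbra (a q) (b q)) v p
      = mbra (dirD a v p) (b p) + mbra (a p) (dirD b v p) :=
  dirD_bilinear (mbraCLM k) (ha.differentiableAt_of_smooth p) (hb.differentiableAt_of_smooth p) v

lemma dirD_fieldStrength {a b : P → Mat k} (ha : ContDiff ℝ ∞ a) (hb : ContDiff ℝ ∞ b)
    (u v w p : P) :
    dirD (fieldStrength a b u v) w p = dirD (dirD b u) w p - dirD (dirD a v) w p
      + (mbra (dirD a w p) (b p) + mbra (a p) (dirD b w p)) := by
  rw [← dirD_mbra ha hb]
  have h1 := (hb.dirD u).differentiableAt_of_smooth p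
  have h2 := (ha.dirD v).differentiableAt_of_smooth p
  rw [← dirD_sub h1 h2,
    ← dirD_add (h1.fun_sub h2) ((contDiff_mbra ha hb).differentiableAt_of_smooth p)]
  rfl

lemma bianchi {a b c : P → Mat k} (ha : ContDiff ℝ ∞ a) (hb : ContDiff ℝ ∞ b)
    (hc : ContDiff ℝ ∞ c) (u v w p : P) :
    cov a u (fieldStrength b c v w) p + cov b v (fieldStrength c a w u) p
      + cov c w (fieldStrength a b u v) p = 0 := by
  simp only [cov, dirD_fieldStrength ha hb, dirD_fieldStrength hb hc, dirD_fieldStrength hc ha]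
  rw [dirD_comm hc v u, dirD_comm hb w u, dirD_comm ha w v]
  have hJ := mbra_jacobi (a p) (b p) (c p)
  simp only [fieldStrength, ← mbraCLM_apply, map_sub, map_add] at *
  simp only [mbraCLM_apply] at *
  rw [mbra_swap (dirD b u p) (c p), mbra_swap (dirD c v p) (a p), mbra_swap (dirD a w p) (b p)]
  rw [← hJ]
  abel

lemma fieldStrength_swap (a b : P → Mat k) (u v p : P) :
    fieldStrength a b u v p = -fieldStrength b a v u p := by
  simp only [fieldStrength]
  rw [mbra_swap]
  abel

lemma cov_neg (a : P → Mat k) (u : P) (f : P → Mat k) (p : P) :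
    cov a u (fun q => -f q) p = -cov a u f p := by
  have : dirD (fun q => -f q) u p = -dirD f u p := by simp [dirD]
  simp only [cov, this, ← mbraCLM_apply, map_neg]
  abel

lemma dirD_minner {a f g : P → Mat k} {p : P} (ha : ∀ i j, a p j i = -a p i j)
    (hf : ContDiff ℝ ∞ f) (hg : ContDiff ℝ ∞ g) (u : P) :
    dirD (fun q => minner (f q) (g q)) u p
      = minner (cov a u f p) (g p) + minner (f p) (cov a u g p) := by
  have h := dirD_bilinear (minnerCLM k) (hf.differentiableAt_of_smooth p)
    (hg.differentiableAt_of_smooth p) u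
  have h2 := minner_mbra ha (f p) (g p)
  simp only [minnerCLM_apply] at h
  rw [h]
  simp only [cov, ← minnerCLM_apply, map_add, add_apply] at *
  linarith

end Curvature

section Pointwise

variable {n k : ℕ}

lemma minner_add_left (A B C : Mat k) : minner (A + B) C = minner A C + minner B C := by
  simp [← minnerCLM_apply]

lemma minner_add_right (A B C : Mat k) : minner A (B + C) = minner A B + minner A C := by
  simp [← minnerCLM_apply]

lemma minner_neg_left (A B : Mat k) : minner (-A) B = -minner A B := by
  simp [← minnerCLM_apply]

lemma minner_neg_right (A B : Mat k) : minner A (-B) = -minner A B := by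
  simp [← minnerCLM_apply]

lemma minner_sub_right (A B C : Mat k) : minner A (B - C) = minner A B - minner A C := by
  simp [← minnerCLM_apply]

lemma minner_smul_left (c : ℝ) (A B : Mat k) : minner (c • A) B = c * minner A B := by
  simp [← minnerCLM_apply]

lemma minner_smul_right (c : ℝ) (A B : Mat k) : minner A (c • B) = c * minner A B := by
  simp [← minnerCLM_apply]

lemma minner_sum_left {ι : Type*} (s : Finset ι) (f : ι → Mat k) (B : Mat k) :
    minner (∑ i ∈ s, f i) B = ∑ i ∈ s, minner (f i) B := by
  simp [← minnerCLM_apply]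

lemma minner_sum_right {ι : Type*} (s : Finset ι) (A : Mat k) (f : ι → Mat k) :
    minner A (∑ i ∈ s, f i) = ∑ i ∈ s, minner A (f i) := by
  simp [← minnerCLM_apply]

lemma msq_smul_add_smul (c d : ℝ) (A B : Mat k) :
    msq (c • A + d • B) = c ^ 2 * msq A + 2 * c * d * minner A B + d ^ 2 * msq B := by
  simp only [msq, minner_add_left, minner_add_right, minner_smul_left, minner_smul_right,
    minner_comm B A]
  ring

/-- Pairing an antisymmetric family with an antisymmetrization. -/
lemma sum_minner_antisymm {F : Fin n → Fin n → Mat k} (hF : ∀ i j, F i j = -F j i)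
    (H : Fin n → Fin n → Mat k) :
    ∑ i, ∑ j, minner (F i j) (H i j - H j i) = 2 * ∑ i, ∑ j, minner (F i j) (H i j) := by
  have : ∑ i, ∑ j, minner (F i j) (H j i) = -∑ i, ∑ j, minner (F i j) (H i j) := by
    rw [Finset.sum_comm, ← Finset.sum_neg_distrib]
    refine Finset.sum_congr rfl fun i _ => ?_
    rw [← Finset.sum_neg_distrib]
    refine Finset.sum_congr rfl fun j _ => ?_
    rw [hF j i, minner_neg_left]
  simp only [minner_sub_right, Finset.sum_sub_distrib, this]
  ring

/-- The algebraic identity behind the monotonicity formula: `F`, `dF`, `J`, `dJ`, `Y` stand for the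
curvature, its covariant derivative, its divergence, the covariant derivative of the latter, and
the contraction of the curvature with the vector `y`. -/
lemma entropy_density_identity {F : Fin n → Fin n → Mat k} {dF : Fin n → Fin n → Fin n → Mat k}
    {J : Fin n → Mat k} {dJ : Fin n → Fin n → Mat k} (y : Fin n → ℝ) {τ : ℝ} (hτ : τ ≠ 0)
    (hF : ∀ i j, F i j = -F j i) (hdF : ∀ l i j, dF l i j = -dF l j i)
    (hB : ∀ l i j, dF l i j + dF i j l + dF j l i = 0)
    (hJ : ∀ j, J j = ∑ i, dF i i j) {Y : Fin n → Mat k} (hY : ∀ j, Y j = ∑ l, y l • F l j)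
    {N : ℝ} (hN : N = ∑ i, ∑ j, msq (F i j)) :
    2 * ∑ i, ∑ j, minner (F i j) (dJ i j - dJ j i)
        + N * (n / (2 * τ) - (∑ i, y i ^ 2) / (4 * τ ^ 2))
      = -(∑ j, msq (τ⁻¹ • Y j + (2 : ℝ) • (-J j))) + 2 / τ * N
        + 2 * ∑ i, ((2 * ∑ j, (minner (dF i i j) (J j) + minner (F i j) (dJ i j))
            - τ⁻¹ * ∑ j, (minner (dF i i j) (Y j)
                + minner (F i j) (F i j + ∑ l, y l • dF i l j))
            + (4 * τ)⁻¹ * (N + y i * (2 * ∑ a, ∑ b, minner (F a b) (dF i a b))))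
          - y i / (2 * τ) * (2 * ∑ j, minner (F i j) (J j) - τ⁻¹ * ∑ j, minner (F i j) (Y j)
            + (4 * τ)⁻¹ * (y i * N))) := by
  have hdiv (Z : Fin n → Mat k) : ∑ i, ∑ j, minner (dF i i j) (Z j) = ∑ j, minner (J j) (Z j) := by
    rw [Finset.sum_comm]
    simp only [hJ, minner_sum_left]
  have hcon (Z : Fin n → Mat k) :
      ∑ i, y i * ∑ j, minner (F i j) (Z j) = ∑ j, minner (Y j) (Z j) := by
    simp only [Finset.mul_sum]
    rw [Finset.sum_comm]
    simp only [hY, minner_sum_left, minner_smul_left]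
  have hbi (l : Fin n) : ∑ a, ∑ b, minner (F a b) (dF l a b)
      = 2 * ∑ a, ∑ b, minner (F a b) (dF a l b) := by
    rw [← sum_minner_antisymm hF fun a b => dF a l b]
    refine Finset.sum_congr rfl fun a _ => Finset.sum_congr rfl fun b _ => ?_
    congr 1
    rw [hdF a l b, ← sub_eq_zero, ← hB l a b]
    abel
  have hcr : ∑ i, ∑ j, minner (F i j) (∑ l, y l • dF i l j)
      = ∑ l, y l * ∑ i, ∑ j, minner (F i j) (dF i l j) := by
    simp only [minner_sum_right, minner_smul_right, Finset.mul_sum]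
    rw [Finset.sum_comm_cycle]
  have hQ : ∑ j, msq (τ⁻¹ • Y j + (2 : ℝ) • (-J j))
      = (τ⁻¹) ^ 2 * (∑ j, minner (Y j) (Y j)) - 4 * τ⁻¹ * (∑ j, minner (Y j) (J j))
        + 4 * ∑ j, minner (J j) (J j) := by
    simp only [msq_smul_add_smul]
    simp only [msq, minner_neg_left, minner_neg_right, Finset.mul_sum,
      ← Finset.sum_sub_distrib, ← Finset.sum_add_distrib]
    refine Finset.sum_congr rfl fun j _ => ?_
    ring
  have hlin (p q r s u w v z : Fin n → ℝ) : ∑ i, ((2 * (p i + q i) - τ⁻¹ * (r i + (s i + u i))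
            + (4 * τ)⁻¹ * (N + y i * (2 * w i)))
          - y i / (2 * τ) * (2 * v i - τ⁻¹ * z i + (4 * τ)⁻¹ * (y i * N)))
      = 2 * ∑ i, p i + 2 * ∑ i, q i - τ⁻¹ * ∑ i, r i - τ⁻¹ * ∑ i, s i - τ⁻¹ * ∑ i, u i
        + ∑ i : Fin n, (4 * τ)⁻¹ * N + (2 * τ)⁻¹ * ∑ i, y i * w i - τ⁻¹ * ∑ i, y i * v i
        + (τ⁻¹) ^ 2 / 2 * ∑ i, y i * z i - N * ((τ⁻¹) ^ 2 / 8) * ∑ i, y i ^ 2 := by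
    simp only [Finset.mul_sum, ← Finset.sum_sub_distrib, ← Finset.sum_add_distrib]
    refine Finset.sum_congr rfl fun i _ => ?_
    field_simp
    ring
  have hsum : ∑ i, ((2 * ∑ j, (minner (dF i i j) (J j) + minner (F i j) (dJ i j))
            - τ⁻¹ * ∑ j, (minner (dF i i j) (Y j)
                + minner (F i j) (F i j + ∑ l, y l • dF i l j))
            + (4 * τ)⁻¹ * (N + y i * (2 * ∑ a, ∑ b, minner (F a b) (dF i a b))))
          - y i / (2 * τ) * (2 * ∑ j, minner (F i j) (J j) - τ⁻¹ * ∑ j, minner (F i j) (Y j)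
            + (4 * τ)⁻¹ * (y i * N)))
      = 2 * ∑ i, ∑ j, minner (dF i i j) (J j) + 2 * ∑ i, ∑ j, minner (F i j) (dJ i j)
        - τ⁻¹ * ∑ i, ∑ j, minner (dF i i j) (Y j) - τ⁻¹ * ∑ i, ∑ j, msq (F i j)
        - τ⁻¹ * ∑ i, ∑ j, minner (F i j) (∑ l, y l • dF i l j)
        + ∑ i : Fin n, (4 * τ)⁻¹ * N
        + (2 * τ)⁻¹ * ∑ i, y i * ∑ a, ∑ b, minner (F a b) (dF i a b)
        - τ⁻¹ * ∑ i, y i * ∑ j, minner (F i j) (J j)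
        + (τ⁻¹) ^ 2 / 2 * ∑ i, y i * ∑ j, minner (F i j) (Y j)
        - N * ((τ⁻¹) ^ 2 / 8) * ∑ i, y i ^ 2 := by
    simp only [Finset.sum_add_distrib (s := Finset.univ (α := Fin n)) (f := fun j => minner _ _),
      minner_add_right, msq]
    exact hlin _ _ _ _ _ _ _ _
  rw [hsum, hQ, sum_minner_antisymm hF, hdiv, hdiv, hcon, hcon, hcr, ← hN]
  simp only [hbi, Finset.sum_const, Finset.card_univ, Fintype.card_fin, nsmul_eq_mul]
  have hc : ∑ i, y i * (2 * ∑ a, ∑ b, minner (F a b) (dF a i b))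
      = 2 * ∑ i, y i * ∑ a, ∑ b, minner (F a b) (dF a i b) := by
    rw [Finset.mul_sum]
    exact Finset.sum_congr rfl fun i _ => by ring
  have hYJ : ∑ j, minner (Y j) (J j) = ∑ j, minner (J j) (Y j) := by simp only [minner_comm]
  rw [hc, hYJ]
  field_simp
  ring

end Pointwise

section SpaceTime

variable {n k : ℕ} {E : Type*} [NormedAddCommGroup E] [NormedSpace ℝ E]

/-- The `i`-th spatial coordinate direction in space-time. -/
def spaceDir (i : Fin n) : ℝ × (Fin n → ℝ) := (0, Pi.single i 1)

/-- The time direction in space-time. -/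
def timeDir (n : ℕ) : ℝ × (Fin n → ℝ) := (1, 0)

lemma hasFDerivAt_slice {f : ℝ × (Fin n → ℝ) → E} (hf : ContDiff ℝ ∞ f) (t : ℝ)
    (x : Fin n → ℝ) : HasFDerivAt (fun y => f (t, y))
      ((fderiv ℝ f (t, x)).comp (ContinuousLinearMap.inr ℝ ℝ (Fin n → ℝ))) x :=
  (hf.differentiableAt_of_smooth (t, x)).hasFDerivAt.comp x (hasFDerivAt_prodMk_right t x)

lemma pd_slice {f : ℝ × (Fin n → ℝ) → E} (hf : ContDiff ℝ ∞ f) (t : ℝ) (x : Fin n → ℝ)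
    (i : Fin n) : pd (fun y => f (t, y)) x i = dirD f (spaceDir i) (t, x) := by
  rw [pd, (hasFDerivAt_slice hf t x).fderiv]
  rfl

lemma hasDerivAt_slice {f : ℝ × (Fin n → ℝ) → E} (hf : ContDiff ℝ ∞ f) (t : ℝ)
    (x : Fin n → ℝ) : HasDerivAt (fun s => f (s, x)) (dirD f (timeDir n) (t, x)) t :=
  (hf.differentiableAt_of_smooth (t, x)).hasFDerivAt.comp_hasDerivAt t
    ((hasDerivAt_id t).prodMk (hasDerivAt_const t x))

/-- The connection component `Γ_i` as a function on space-time. -/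
def connST (Γ : Conn n k) (i : Fin n) (p : ℝ × (Fin n → ℝ)) : Mat k := Γ p.1 p.2 i

/-- The curvature component `F_{ij}` as a function on space-time. -/
def curvST (Γ : Conn n k) (i j : Fin n) : ℝ × (Fin n → ℝ) → Mat k :=
  fieldStrength (connST Γ i) (connST Γ j) (spaceDir i) (spaceDir j)

lemma IsSmoothConn.contDiff_connST {Γ : Conn n k} (h : IsSmoothConn Γ) (i : Fin n) :
    ContDiff ℝ ∞ (connST Γ i) :=
  contDiff_pi.1 h.1 i

lemma IsSmoothConn.contDiff_curvST {Γ : Conn n k} (h : IsSmoothConn Γ) (i j : Fin n) :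
    ContDiff ℝ ∞ (curvST Γ i j) :=
  contDiff_fieldStrength (h.contDiff_connST i) (h.contDiff_connST j) _ _

lemma IsSmoothConn.curv_eq {Γ : Conn n k} (h : IsSmoothConn Γ) (t : ℝ) (x : Fin n → ℝ)
    (i j : Fin n) : curv Γ t x i j = curvST Γ i j (t, x) := by
  simp only [curv, curvST, fieldStrength, ← pd_slice (h.contDiff_connST _)]
  rfl

lemma IsSmoothConn.covD_curv_eq {Γ : Conn n k} (h : IsSmoothConn Γ) (t : ℝ) (x : Fin n → ℝ)
    (l i j : Fin n) : covD Γ t (fun y => curv Γ t y i j) x l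
      = cov (connST Γ l) (spaceDir l) (curvST Γ i j) (t, x) := by
  simp only [covD, cov, h.curv_eq, ← pd_slice (h.contDiff_curvST _ _)]
  rfl

lemma IsSmoothConn.tderiv_eq {Γ : Conn n k} (h : IsSmoothConn Γ) (t : ℝ) (x : Fin n → ℝ)
    (j : Fin n) : tderiv Γ t x j = dirD (connST Γ j) (timeDir n) (t, x) :=
  (hasDerivAt_slice (h.contDiff_connST j) t x).deriv

lemma curvST_swap (Γ : Conn n k) (i j : Fin n) (p : ℝ × (Fin n → ℝ)) :
    curvST Γ i j p = -curvST Γ j i p :=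
  fieldStrength_swap _ _ _ _ _

lemma cov_curvST_swap (Γ : Conn n k) (l i j : Fin n) (p : ℝ × (Fin n → ℝ)) :
    cov (connST Γ l) (spaceDir l) (curvST Γ i j) p
      = -cov (connST Γ l) (spaceDir l) (curvST Γ j i) p := by
  rw [← cov_neg]
  congr 1
  funext q
  exact curvST_swap Γ i j q

/-- The evolution of the curvature, an instance of the Bianchi identity in the temporal gauge. -/
lemma IsSmoothConn.dirD_timeDir_curvST {Γ : Conn n k} (h : IsSmoothConn Γ) (i j : Fin n)
    (p : ℝ × (Fin n → ℝ)) : dirD (curvST Γ i j) (timeDir n) p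
      = cov (connST Γ i) (spaceDir i) (dirD (connST Γ j) (timeDir n)) p
        - cov (connST Γ j) (spaceDir j) (dirD (connST Γ i) (timeDir n)) p := by
  have hz : ContDiff ℝ ∞ (fun _ : ℝ × (Fin n → ℝ) => (0 : Mat k)) := contDiff_const
  have hb := bianchi hz (h.contDiff_connST i) (h.contDiff_connST j) (timeDir n) (spaceDir i)
    (spaceDir j) p
  have h0 (A : Mat k) : mbra 0 A = 0 := by simp [← mbraCLM_apply]
  have h1 (v w : ℝ × (Fin n → ℝ)) : dirD (fun _ => (0 : Mat k)) v w = 0 := by simp [dirD]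
  have h2 : fieldStrength (connST Γ j) (fun _ => 0) (spaceDir j) (timeDir n)
      = fun q => -dirD (connST Γ j) (timeDir n) q := by
    funext q
    simp only [fieldStrength, h1, mbra_swap _ 0, h0]
    abel
  have h3 : fieldStrength (fun _ => 0) (connST Γ i) (timeDir n) (spaceDir i)
      = dirD (connST Γ i) (timeDir n) := by
    funext q
    simp only [fieldStrength, h1, h0]
    abel
  have h4 : cov (fun _ => 0) (timeDir n) (curvST Γ i j) p
      = dirD (curvST Γ i j) (timeDir n) p := by
    simp only [cov, h0, add_zero]
  rw [h2, h3, cov_neg] at hb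
  rw [← h4]
  refine sub_eq_zero.1 (Eq.trans ?_ hb)
  rw [curvST]
  abel

/-- A function on space-time that vanishes at all points whose spatial part is outside `K`. -/
def VanishesOff (K : Set (Fin n → ℝ)) (f : ℝ × (Fin n → ℝ) → E) : Prop :=
  ∀ p : ℝ × (Fin n → ℝ), p.2 ∉ K → f p = 0

lemma VanishesOff.dirD {K : Set (Fin n → ℝ)} (hK : IsClosed K) {f : ℝ × (Fin n → ℝ) → E}
    (hf : VanishesOff K f) (v : ℝ × (Fin n → ℝ)) : VanishesOff K (dirD f v) := by
  intro p hp
  refine dirD_eq_zero ?_ v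
  filter_upwards [(hK.isOpen_compl.preimage continuous_snd).mem_nhds hp] with q hq
  exact hf q hq

lemma SuppIn.vanishesOff_connST {Γ : Conn n k} {K : Set (Fin n → ℝ)} (h : SuppIn Γ K)
    (i : Fin n) : VanishesOff K (connST Γ i) := by
  intro p hp
  simp [connST, h p.1 p.2 hp]

lemma SuppIn.vanishesOff_curvST {Γ : Conn n k} {K : Set (Fin n → ℝ)} (hK : IsClosed K)
    (h : SuppIn Γ K) (i j : Fin n) : VanishesOff K (curvST Γ i j) := by
  intro p hp
  simp [curvST, fieldStrength, (h.vanishesOff_connST _).dirD hK _ p hp, h.vanishesOff_connST _ p hp,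
    ← mbraCLM_apply]

lemma integrable_of_continuous_of_eq_zero {K : Set (Fin n → ℝ)} (hK : IsCompact K)
    {g : (Fin n → ℝ) → ℝ} (hg : Continuous g) (h0 : ∀ x, x ∉ K → g x = 0) : Integrable g :=
  hg.integrable_of_hasCompactSupport (HasCompactSupport.intro hK h0)

end SpaceTime

section Gaussian

variable {n : ℕ}

lemma hasDerivAt_gauss {t t0 : ℝ} (ht : t < t0) (x0 x : Fin n → ℝ) :
    HasDerivAt (fun s => gauss (x0, t0) x s)
      ((n / (2 * (t0 - t)) - (∑ i, (x i - x0 i) ^ 2) / (4 * (t0 - t) ^ 2))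
        * gauss (x0, t0) x t) t := by
  have hτ : 0 < t0 - t := sub_pos.2 ht
  have hb : 0 < 4 * Real.pi * (t0 - t) := by positivity
  have h1 : HasDerivAt (fun s => t0 - s) (-1) t := by
    simpa using (hasDerivAt_id t).const_sub t0
  have h2 := (h1.const_mul (4 * Real.pi)).rpow_const (p := -(n : ℝ) / 2) (Or.inl hb.ne')
  have h3 := ((h1.const_mul 4).fun_inv (by positivity)).const_mul
    (-(∑ i, (x i - x0 i) ^ 2)) |>.exp
  have h4 := h2.mul h3
  simp only [gauss, div_eq_mul_inv _ (4 * (t0 - _))]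
  refine h4.congr_deriv ?_
  rw [Real.rpow_sub_one hb.ne']
  field_simp
  ring

lemma continuous_gauss {t t0 : ℝ} (x0 : Fin n → ℝ) :
    Continuous (fun x => gauss (x0, t0) x t) := by
  unfold gauss
  fun_prop

lemma continuousOn_gauss {t0 : ℝ} (x0 : Fin n → ℝ) :
    ContinuousOn (fun p : ℝ × (Fin n → ℝ) => gauss (x0, t0) p.2 p.1) {p | p.1 < t0} := by
  unfold gauss
  refine ContinuousOn.mul (ContinuousOn.rpow_const (by fun_prop) ?_)
    (ContinuousOn.rexp (ContinuousOn.div (by fun_prop) (by fun_prop) ?_))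
  · intro p hp
    have : 0 < t0 - p.1 := sub_pos.2 hp
    left
    positivity
  · intro p hp
    have : 0 < t0 - p.1 := sub_pos.2 hp
    positivity

lemma hasLineDerivAt_gauss {t t0 : ℝ} (ht : t < t0) (x0 x : Fin n → ℝ) (i : Fin n) :
    HasLineDerivAt ℝ (fun y => gauss (x0, t0) y t)
      (-((x i - x0 i) / (2 * (t0 - t))) * gauss (x0, t0) x t) x (Pi.single i 1) := by
  have hτ : 0 < t0 - t := sub_pos.2 ht
  have h1 (m : Fin n) : HasDerivAt
      (fun s : ℝ => ((x + s • Pi.single i (1 : ℝ) : Fin n → ℝ) m - x0 m) ^ 2)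
      (2 * (x m - x0 m) * Pi.single (M := fun _ => ℝ) i (1 : ℝ) m) 0 := by
    have := ((((hasDerivAt_id (0 : ℝ)).mul_const
      (Pi.single (M := fun _ => ℝ) i (1 : ℝ) m)).const_add (x m)).sub_const (x0 m)).fun_pow 2
    simpa using this
  have h2 := (((HasDerivAt.fun_sum (u := Finset.univ) fun m _ => h1 m).neg.div_const
    (4 * (t0 - t))).exp).const_mul ((4 * Real.pi * (t0 - t)) ^ (-(n : ℝ) / 2))
  unfold HasLineDerivAt gauss
  refine h2.congr_deriv ?_
  simp [Pi.single_apply]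
  field_simp
  ring

/-- Integration by parts against the Gaussian weight. -/
lemma integral_weighted_divergence {K : Set (Fin n → ℝ)} (hK : IsCompact K) {t t0 : ℝ}
    (ht : t < t0) (x0 : Fin n → ℝ) {g : ℝ × (Fin n → ℝ) → ℝ} (hg : ContDiff ℝ ∞ g)
    (h0 : VanishesOff K g) (i : Fin n) :
    Integrable (fun x => (dirD g (spaceDir i) (t, x)
        - (x i - x0 i) / (2 * (t0 - t)) * g (t, x)) * gauss (x0, t0) x t)
      ∧ ∫ x, (dirD g (spaceDir i) (t, x)
        - (x i - x0 i) / (2 * (t0 - t)) * g (t, x)) * gauss (x0, t0) x t = 0 := by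
  have hG : Continuous (fun x => gauss (x0, t0) x t) := continuous_gauss x0
  have hgc : Continuous fun x => g (t, x) := hg.continuous.comp (by fun_prop)
  have hdc : Continuous fun x => dirD g (spaceDir i) (t, x) :=
    (hg.dirD (spaceDir i)).continuous.comp (by fun_prop)
  have hd0 := h0.dirD hK.isClosed (spaceDir i)
  have i1 : Integrable fun x => -((x i - x0 i) / (2 * (t0 - t))) * gauss (x0, t0) x t * g (t, x) :=
    integrable_of_continuous_of_eq_zero hK (by fun_prop) fun x hx => by simp [h0 (t, x) hx]
  have i2 : Integrable fun x => gauss (x0, t0) x t * dirD g (spaceDir i) (t, x) :=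
    integrable_of_continuous_of_eq_zero hK (by fun_prop) fun x hx => by simp [hd0 (t, x) hx]
  have i3 : Integrable fun x => gauss (x0, t0) x t * g (t, x) :=
    integrable_of_continuous_of_eq_zero hK (by fun_prop) fun x hx => by simp [h0 (t, x) hx]
  have key := integral_bilinear_hasLineDerivAt_right_eq_neg_left_of_integrable
    (μ := (volume : Measure (Fin n → ℝ))) (B := ContinuousLinearMap.mul ℝ ℝ)
    (f := fun x => gauss (x0, t0) x t) (g := fun x => g (t, x))
    (f' := fun x => -((x i - x0 i) / (2 * (t0 - t))) * gauss (x0, t0) x t)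
    (g' := fun x => dirD g (spaceDir i) (t, x)) (v := Pi.single i 1) i1 i2 i3
    (fun x _ => hasLineDerivAt_gauss ht x0 x i)
    (fun x _ => (hasFDerivAt_slice hg t x).hasLineDerivAt _)
  simp only [ContinuousLinearMap.mul_apply'] at key
  have heq : (fun x => (dirD g (spaceDir i) (t, x)
        - (x i - x0 i) / (2 * (t0 - t)) * g (t, x)) * gauss (x0, t0) x t)
      = fun x => gauss (x0, t0) x t * dirD g (spaceDir i) (t, x)
        + -((x i - x0 i) / (2 * (t0 - t))) * gauss (x0, t0) x t * g (t, x) := by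
    funext x
    ring
  rw [heq]
  refine ⟨i2.add i1, ?_⟩
  rw [integral_add i2 i1, key]
  ring

/-- Differentiation in time of a Gaussian-weighted spatial integral. -/
lemma hasDerivAt_integral_mul_gauss {K : Set (Fin n → ℝ)} (hK : IsCompact K) {t t0 : ℝ}
    (ht : t < t0) (x0 : Fin n → ℝ) {g : ℝ × (Fin n → ℝ) → ℝ} (hg : ContDiff ℝ ∞ g)
    (h0 : VanishesOff K g) :
    HasDerivAt (fun s => ∫ x, g (s, x) * gauss (x0, t0) x s)
      (∫ x, (dirD g (timeDir n) (t, x) + g (t, x) * (n / (2 * (t0 - t))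
        - (∑ i, (x i - x0 i) ^ 2) / (4 * (t0 - t) ^ 2))) * gauss (x0, t0) x t) t := by
  let H : ℝ × (Fin n → ℝ) → ℝ := fun p => (dirD g (timeDir n) p + g p * (n / (2 * (t0 - p.1))
        - (∑ i, (p.2 i - x0 i) ^ 2) / (4 * (t0 - p.1) ^ 2))) * gauss (x0, t0) p.2 p.1
  have hgc := hg.continuous
  have hdc := (hg.dirD (timeDir n)).continuous
  have hd0 := h0.dirD hK.isClosed (timeDir n)
  have hH : ContinuousOn H {p | p.1 < t0} := by
    refine ContinuousOn.mul (hdc.continuousOn.add (hgc.continuousOn.mul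
      (ContinuousOn.sub (ContinuousOn.div (by fun_prop) (by fun_prop) ?_)
        (ContinuousOn.div (by fun_prop) (by fun_prop) ?_)))) (continuousOn_gauss x0)
    all_goals
      intro p hp
      have : 0 < t0 - p.1 := sub_pos.2 hp
      positivity
  have hH0 (p : ℝ × (Fin n → ℝ)) (hp : p.2 ∉ K) : H p = 0 := by
    simp [H, h0 p hp, hd0 p hp]
  obtain ⟨b, htb, hb⟩ := exists_between ht
  have hsub : Icc (t - 1) b ×ˢ K ⊆ {p : ℝ × (Fin n → ℝ) | p.1 < t0} :=
    fun p hp => hp.1.2.trans_lt hb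
  obtain ⟨C, hC⟩ := (isCompact_Icc.prod hK).exists_bound_of_continuousOn (hH.mono hsub)
  have hHt : Continuous fun x => H (t, x) :=
    hH.comp_continuous (f := fun x : Fin n → ℝ => (t, x)) (by fun_prop) fun _ => ht
  refine (hasDerivAt_integral_of_dominated_loc_of_deriv_le (μ := volume)
    (F := fun s x => g (s, x) * gauss (x0, t0) x s) (F' := fun s x => H (s, x))
    (bound := K.indicator fun _ => C) (Icc_mem_nhds (sub_one_lt t) htb) ?_ ?_ ?_ ?_ ?_ ?_).2
  · exact Eventually.of_forall fun s =>
      ((hgc.comp (by fun_prop)).mul (continuous_gauss x0)).aestronglyMeasurable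
  · exact integrable_of_continuous_of_eq_zero hK
      ((hgc.comp (by fun_prop)).mul (continuous_gauss x0)) fun x hx => by simp [h0 (t, x) hx]
  · exact hHt.aestronglyMeasurable
  · refine Eventually.of_forall fun x s hs => ?_
    by_cases hx : x ∈ K
    · simpa [hx] using hC (s, x) ⟨hs, hx⟩
    · simp [hx, hH0 (s, x) hx]
  · exact (integrable_indicator_iff hK.measurableSet).2
      (integrableOn_const hK.measure_lt_top.ne)
  · refine Eventually.of_forall fun x s hs => ?_
    have hst : s < t0 := hs.2.trans_lt hb
    refine ((hasDerivAt_slice hg s x).mul (hasDerivAt_gauss hst x0 x)).congr_deriv ?_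
    simp only [H]
    ring

end Gaussian

section Flux

variable {n k : ℕ}

/-- The current `∂_tΓ_j` as a function on space-time. -/
def current (Γ : Conn n k) (j : Fin n) : ℝ × (Fin n → ℝ) → Mat k := dirD (connST Γ j) (timeDir n)

/-- The contraction of `x - x₀` with the curvature as a function on space-time. -/
def radialCurv (Γ : Conn n k) (x0 : Fin n → ℝ) (j : Fin n) (p : ℝ × (Fin n → ℝ)) : Mat k :=
  ∑ l, (p.2 l - x0 l) • curvST Γ l j p

/-- The squared norm of the curvature as a function on space-time. -/
def curvSq (Γ : Conn n k) (p : ℝ × (Fin n → ℝ)) : ℝ := ∑ i, ∑ j, msq (curvST Γ i j p)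

/-- The vector field whose Gaussian-weighted divergence enters the monotonicity formula. -/
def flux (Γ : Conn n k) (x0 : Fin n → ℝ) (τ : ℝ) (i : Fin n) (p : ℝ × (Fin n → ℝ)) : ℝ :=
  2 * ∑ j, minner (curvST Γ i j p) (current Γ j p)
    - τ⁻¹ * ∑ j, minner (curvST Γ i j p) (radialCurv Γ x0 j p)
    + (4 * τ)⁻¹ * ((p.2 i - x0 i) * curvSq Γ p)

variable {Γ : Conn n k}

lemma IsSmoothConn.contDiff_current (h : IsSmoothConn Γ) (j : Fin n) :
    ContDiff ℝ ∞ (current Γ j) :=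
  (h.contDiff_connST j).dirD _

lemma contDiff_coord_sub (x0 : Fin n → ℝ) (i : Fin n) :
    ContDiff ℝ ∞ fun p : ℝ × (Fin n → ℝ) => p.2 i - x0 i := by
  fun_prop

lemma IsSmoothConn.contDiff_radialCurv (h : IsSmoothConn Γ) (x0 : Fin n → ℝ) (j : Fin n) :
    ContDiff ℝ ∞ (radialCurv Γ x0 j) :=
  ContDiff.sum fun l _ => (contDiff_coord_sub x0 l).smul (h.contDiff_curvST l j)

lemma IsSmoothConn.contDiff_curvSq (h : IsSmoothConn Γ) : ContDiff ℝ ∞ (curvSq Γ) :=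
  ContDiff.sum fun i _ => ContDiff.sum fun j _ =>
    contDiff_minner (h.contDiff_curvST i j) (h.contDiff_curvST i j)

lemma IsSmoothConn.contDiff_flux (h : IsSmoothConn Γ) (x0 : Fin n → ℝ) (τ : ℝ) (i : Fin n) :
    ContDiff ℝ ∞ (flux Γ x0 τ i) :=
  ((contDiff_const.mul (ContDiff.sum fun j _ =>
      contDiff_minner (h.contDiff_curvST i j) (h.contDiff_current j))).sub
    (contDiff_const.mul (ContDiff.sum fun j _ =>
      contDiff_minner (h.contDiff_curvST i j) (h.contDiff_radialCurv x0 j)))).add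
    (contDiff_const.mul ((contDiff_coord_sub x0 i).mul h.contDiff_curvSq))

lemma dirD_coord_sub (x0 : Fin n → ℝ) (i l : Fin n) (p : ℝ × (Fin n → ℝ)) :
    dirD (fun q : ℝ × (Fin n → ℝ) => q.2 l - x0 l) (spaceDir i) p
      = Pi.single (M := fun _ => ℝ) i 1 l := by
  have : HasFDerivAt (fun q : ℝ × (Fin n → ℝ) => q.2 l - x0 l)
      ((ContinuousLinearMap.proj l).comp (ContinuousLinearMap.snd ℝ ℝ (Fin n → ℝ))) p :=
    (((ContinuousLinearMap.proj (R := ℝ) (φ := fun _ : Fin n => ℝ) l).comp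
      (ContinuousLinearMap.snd ℝ ℝ (Fin n → ℝ))).hasFDerivAt).sub_const (x0 l)
  rw [dirD, this.fderiv]
  rfl

lemma IsSmoothConn.cov_radialCurv (h : IsSmoothConn Γ) (x0 : Fin n → ℝ) (i j : Fin n)
    (p : ℝ × (Fin n → ℝ)) : cov (connST Γ i) (spaceDir i) (radialCurv Γ x0 j) p
      = curvST Γ i j p
        + ∑ l, (p.2 l - x0 l) • cov (connST Γ i) (spaceDir i) (curvST Γ l j) p := by
  have h1 : dirD (radialCurv Γ x0 j) (spaceDir i) p = curvST Γ i j p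
      + ∑ l, (p.2 l - x0 l) • dirD (curvST Γ l j) (spaceDir i) p := by
    change dirD (fun q => ∑ l, (q.2 l - x0 l) • curvST Γ l j q) _ p = _
    have hs (l : Fin n) : ContDiff ℝ ∞ fun q => (q.2 l - x0 l) • curvST Γ l j q :=
      (contDiff_coord_sub x0 l).smul (h.contDiff_curvST l j)
    rw [dirD_sum _ fun l _ => (hs l).differentiableAt_of_smooth p]
    simp only [dirD_smul ((contDiff_coord_sub x0 _).differentiableAt_of_smooth p)
      ((h.contDiff_curvST _ j).differentiableAt_of_smooth p), dirD_coord_sub,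
      Finset.sum_add_distrib]
    congr 1
    simp [Pi.single_apply]
  simp only [cov, h1, smul_add, Finset.sum_add_distrib]
  simp only [radialCurv, ← mbraCLM_apply, map_sum, map_smul]
  abel

lemma IsSmoothConn.dirD_sum_minner (h : IsSmoothConn Γ) {ι : Type*} (s : Finset ι)
    {f g : ι → ℝ × (Fin n → ℝ) → Mat k} (hf : ∀ j, ContDiff ℝ ∞ (f j))
    (hg : ∀ j, ContDiff ℝ ∞ (g j)) (i : Fin n) (p : ℝ × (Fin n → ℝ)) :
    dirD (fun q => ∑ j ∈ s, minner (f j q) (g j q)) (spaceDir i) p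
      = ∑ j ∈ s, (minner (cov (connST Γ i) (spaceDir i) (f j) p) (g j p)
        + minner (f j p) (cov (connST Γ i) (spaceDir i) (g j) p)) := by
  rw [dirD_sum _ fun j _ => (contDiff_minner (hf j) (hg j)).differentiableAt_of_smooth p]
  exact Finset.sum_congr rfl fun j _ =>
    dirD_minner (a := connST Γ i) (h.2 p.1 p.2 i) (hf j) (hg j) _

lemma IsSmoothConn.dirD_spaceDir_curvSq (h : IsSmoothConn Γ) (i : Fin n)
    (p : ℝ × (Fin n → ℝ)) : dirD (curvSq Γ) (spaceDir i) p
      = 2 * ∑ a, ∑ b, minner (curvST Γ a b p)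
          (cov (connST Γ i) (spaceDir i) (curvST Γ a b) p) := by
  change dirD (fun q => ∑ a, ∑ b, minner (curvST Γ a b q) (curvST Γ a b q)) _ p = _
  rw [dirD_sum _ fun a _ => (ContDiff.sum fun b _ => contDiff_minner (h.contDiff_curvST a b)
    (h.contDiff_curvST a b)).differentiableAt_of_smooth p]
  simp only [h.dirD_sum_minner _ (h.contDiff_curvST _) (h.contDiff_curvST _), Finset.mul_sum]
  refine Finset.sum_congr rfl fun a _ => Finset.sum_congr rfl fun b _ => ?_
  rw [minner_comm (cov _ _ _ _)]
  ring

lemma IsSmoothConn.dirD_timeDir_curvSq (h : IsSmoothConn Γ) (p : ℝ × (Fin n → ℝ)) :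
    dirD (curvSq Γ) (timeDir n) p
      = 2 * ∑ i, ∑ j, minner (curvST Γ i j p)
          (cov (connST Γ i) (spaceDir i) (current Γ j) p
            - cov (connST Γ j) (spaceDir j) (current Γ i) p) := by
  change dirD (fun q => ∑ a, ∑ b, minner (curvST Γ a b q) (curvST Γ a b q)) _ p = _
  have hd (a b : Fin n) := (h.contDiff_curvST a b).differentiableAt_of_smooth p
  have hm (a b : Fin n) := (contDiff_minner (h.contDiff_curvST a b)
    (h.contDiff_curvST a b)).differentiableAt_of_smooth p
  have hs (a : Fin n) := (ContDiff.sum (s := Finset.univ) fun b _ => contDiff_minner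
    (h.contDiff_curvST a b) (h.contDiff_curvST a b)).differentiableAt_of_smooth p
  rw [dirD_sum _ fun a _ => hs a, Finset.mul_sum]
  refine Finset.sum_congr rfl fun a _ => ?_
  rw [dirD_sum _ fun b _ => hm a b, Finset.mul_sum]
  refine Finset.sum_congr rfl fun b _ => ?_
  change dirD (fun q => minnerCLM k (curvST Γ a b q) (curvST Γ a b q)) _ p = _
  rw [dirD_bilinear _ (hd a b) (hd a b), minnerCLM_apply, minnerCLM_apply,
    minner_comm (dirD _ _ _), h.dirD_timeDir_curvST]
  simp only [current]
  ring

lemma IsSmoothConn.dirD_flux (h : IsSmoothConn Γ) (x0 : Fin n → ℝ) (τ : ℝ) (i : Fin n)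
    (p : ℝ × (Fin n → ℝ)) : dirD (flux Γ x0 τ i) (spaceDir i) p
      = 2 * ∑ j, (minner (cov (connST Γ i) (spaceDir i) (curvST Γ i j) p) (current Γ j p)
          + minner (curvST Γ i j p) (cov (connST Γ i) (spaceDir i) (current Γ j) p))
        - τ⁻¹ * ∑ j, (minner (cov (connST Γ i) (spaceDir i) (curvST Γ i j) p) (radialCurv Γ x0 j p)
          + minner (curvST Γ i j p) (curvST Γ i j p
            + ∑ l, (p.2 l - x0 l) • cov (connST Γ i) (spaceDir i) (curvST Γ l j) p))
        + (4 * τ)⁻¹ * (curvSq Γ p + (p.2 i - x0 i) * (2 * ∑ a, ∑ b, minner (curvST Γ a b p)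
          (cov (connST Γ i) (spaceDir i) (curvST Γ a b) p))) := by
  have hP : ContDiff ℝ ∞ fun q => ∑ j, minner (curvST Γ i j q) (current Γ j q) :=
    ContDiff.sum fun j _ => contDiff_minner (h.contDiff_curvST i j) (h.contDiff_current j)
  have hS : ContDiff ℝ ∞ fun q => ∑ j, minner (curvST Γ i j q) (radialCurv Γ x0 j q) :=
    ContDiff.sum fun j _ => contDiff_minner (h.contDiff_curvST i j) (h.contDiff_radialCurv x0 j)
  have hN : ContDiff ℝ ∞ fun q => (q.2 i - x0 i) • curvSq Γ q :=
    (contDiff_coord_sub x0 i).smul h.contDiff_curvSq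
  have hc (c : ℝ) {f : ℝ × (Fin n → ℝ) → ℝ} (hf : ContDiff ℝ ∞ f) :
      dirD (fun q => c * f q) (spaceDir i) p = c * dirD f (spaceDir i) p := by
    simp [dirD, fderiv_const_mul (hf.differentiableAt_of_smooth p)]
  have hP' := (contDiff_const (c := (2 : ℝ))).mul hP
  have hS' := (contDiff_const (c := τ⁻¹)).mul hS
  have hN' := (contDiff_const (c := (4 * τ)⁻¹)).mul hN
  change dirD (fun q => 2 * (∑ j, minner (curvST Γ i j q) (current Γ j q))
    - τ⁻¹ * (∑ j, minner (curvST Γ i j q) (radialCurv Γ x0 j q))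
    + (4 * τ)⁻¹ * ((q.2 i - x0 i) • curvSq Γ q)) _ p = _
  rw [dirD_add ((hP'.sub hS').differentiableAt_of_smooth p) (hN'.differentiableAt_of_smooth p),
    dirD_sub (hP'.differentiableAt_of_smooth p) (hS'.differentiableAt_of_smooth p),
    hc _ hP, hc _ hS, hc _ hN,
    h.dirD_sum_minner _ (h.contDiff_curvST i) h.contDiff_current,
    h.dirD_sum_minner _ (h.contDiff_curvST i) (h.contDiff_radialCurv x0),
    dirD_smul ((contDiff_coord_sub x0 i).differentiableAt_of_smooth p)
      (h.contDiff_curvSq.differentiableAt_of_smooth p), dirD_coord_sub, h.dirD_spaceDir_curvSq]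
  simp only [h.cov_radialCurv, Pi.single_eq_same, smul_eq_mul, one_mul]

lemma SuppIn.vanishesOff_curvSq {K : Set (Fin n → ℝ)} (hK : IsClosed K) (hs : SuppIn Γ K) :
    VanishesOff K (curvSq Γ) := by
  intro p hp
  simp [curvSq, hs.vanishesOff_curvST hK _ _ p hp, msq, minner]

lemma SuppIn.vanishesOff_flux {K : Set (Fin n → ℝ)} (hK : IsClosed K) (hs : SuppIn Γ K)
    (x0 : Fin n → ℝ) (τ : ℝ) (i : Fin n) : VanishesOff K (flux Γ x0 τ i) := by
  intro p hp
  simp [flux, hs.vanishesOff_curvSq hK p hp, hs.vanishesOff_curvST hK _ _ p hp, minner]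

/-- The time derivative of the Gaussian-weighted Yang-Mills energy along the flow. -/
lemma hasDerivAt_weighted_energy (h : IsSmoothConn Γ) {T : ℝ} (hflow : IsYMFlowOn Γ (Ico 0 T))
    {K : Set (Fin n → ℝ)} (hK : IsCompact K) (hs : SuppIn Γ K) (x0 : Fin n → ℝ) {t t0 : ℝ}
    (htT : t ∈ Ico 0 T) (ht : t < t0) :
    HasDerivAt (fun s => ∫ x, normF2 Γ s x * gauss (x0, t0) x s)
      (-(∫ x, (∑ j, msq ((t0 - t)⁻¹ • (∑ i, (x i - x0 i) • curv Γ t x i j)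
            + (2 : ℝ) • dstarF Γ t x j)) * gauss (x0, t0) x t)
        + 2 / (t0 - t) * ∫ x, normF2 Γ t x * gauss (x0, t0) x t) t := by
  have hτ : t0 - t ≠ 0 := (sub_pos.2 ht).ne'
  have hN (s : ℝ) (x : Fin n → ℝ) : normF2 Γ s x = curvSq Γ (s, x) := by
    simp only [normF2, curvSq, h.curv_eq]
  have hJ (x : Fin n → ℝ) (j : Fin n) : current Γ j (t, x)
      = ∑ i, cov (connST Γ i) (spaceDir i) (curvST Γ i j) (t, x) := by
    simp only [current, ← h.tderiv_eq, hflow t htT, h.covD_curv_eq]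
  have hD (x : Fin n → ℝ) (j : Fin n) : dstarF Γ t x j = -current Γ j (t, x) := by
    simp only [dstarF, hJ, h.covD_curv_eq]
  have hY (x : Fin n → ℝ) (j : Fin n) :
      ∑ i, (x i - x0 i) • curv Γ t x i j = radialCurv Γ x0 j (t, x) := by
    simp only [radialCurv, h.curv_eq]
  simp only [hN, hD, hY]
  have hdiv (i : Fin n) := integral_weighted_divergence hK ht x0
    (h.contDiff_flux x0 (t0 - t) i) (hs.vanishesOff_flux hK.isClosed x0 (t0 - t) i) i
  refine (hasDerivAt_integral_mul_gauss hK ht x0 h.contDiff_curvSq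
    (hs.vanishesOff_curvSq hK.isClosed)).congr_deriv ?_
  have hint1 : Integrable fun x => (∑ j, msq ((t0 - t)⁻¹ • radialCurv Γ x0 j (t, x)
      + (2 : ℝ) • -current Γ j (t, x))) * gauss (x0, t0) x t := by
    refine integrable_of_continuous_of_eq_zero hK
      (Continuous.mul ?_ (continuous_gauss x0)) fun x hx => ?_
    · have : ContDiff ℝ ∞ fun p => ∑ j, msq ((t0 - t)⁻¹ • radialCurv Γ x0 j p
          + (2 : ℝ) • -current Γ j p) := by
        refine ContDiff.sum fun j _ => ?_
        have hc : ContDiff ℝ ∞ fun p => (t0 - t)⁻¹ • radialCurv Γ x0 j p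
            + (2 : ℝ) • -current Γ j p :=
          ((h.contDiff_radialCurv x0 j).const_smul _).add ((h.contDiff_current j).neg.const_smul _)
        exact contDiff_minner hc hc
      exact this.continuous.comp (by fun_prop : Continuous fun x : Fin n → ℝ => (t, x))
    · have h1 (j : Fin n) : current Γ j (t, x) = 0 :=
        (hs.vanishesOff_connST j).dirD hK.isClosed _ (t, x) hx
      simp [h1, radialCurv, hs.vanishesOff_curvST hK.isClosed _ _ (t, x) hx, msq, minner]
  have hint2 : Integrable fun x => curvSq Γ (t, x) * gauss (x0, t0) x t :=
    integrable_of_continuous_of_eq_zero hK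
      ((h.contDiff_curvSq.continuous.comp (by fun_prop)).mul (continuous_gauss x0)) fun x hx => by
        simp [hs.vanishesOff_curvSq hK.isClosed (t, x) hx]
  have hpt (x : Fin n → ℝ) := entropy_density_identity (fun i => x i - x0 i) hτ
    (fun i j => curvST_swap Γ i j (t, x)) (fun l i j => cov_curvST_swap Γ l i j (t, x))
    (fun l i j => bianchi (h.contDiff_connST l) (h.contDiff_connST i) (h.contDiff_connST j)
      (spaceDir l) (spaceDir i) (spaceDir j) (t, x))
    (hJ x) (dJ := fun i j => cov (connST Γ i) (spaceDir i) (current Γ j) (t, x))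
    (Y := fun j => radialCurv Γ x0 j (t, x)) (fun j => rfl) (N := curvSq Γ (t, x)) rfl
  have hfun : (fun x => (dirD (curvSq Γ) (timeDir n) (t, x) + curvSq Γ (t, x)
        * (n / (2 * (t0 - t)) - (∑ i, (x i - x0 i) ^ 2) / (4 * (t0 - t) ^ 2)))
        * gauss (x0, t0) x t)
      = fun x => -((∑ j, msq ((t0 - t)⁻¹ • radialCurv Γ x0 j (t, x)
          + (2 : ℝ) • -current Γ j (t, x))) * gauss (x0, t0) x t)
        + 2 / (t0 - t) * (curvSq Γ (t, x) * gauss (x0, t0) x t)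
        + 2 * ∑ i, (dirD (flux Γ x0 (t0 - t) i) (spaceDir i) (t, x)
          - (x i - x0 i) / (2 * (t0 - t)) * flux Γ x0 (t0 - t) i (t, x))
            * gauss (x0, t0) x t := by
    funext x
    rw [h.dirD_timeDir_curvSq, hpt x, ← Finset.sum_mul]
    simp only [h.dirD_flux, flux]
    ring
  rw [hfun, integral_add (hint1.fun_neg.fun_add (hint2.const_mul _))
      ((integrable_finsetSum _ fun i _ => (hdiv i).1).const_mul _),
    integral_add hint1.fun_neg (hint2.const_mul _), integral_const_mul, integral_const_mul,
    integral_finsetSum _ fun i _ => (hdiv i).1, integral_neg]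
  simp only [(hdiv _).2, Finset.sum_const_zero, mul_zero, add_zero]

end Flux

/-- Differentiability of `R ↦ Φ_{z₀}(R;Γ)` on `(0,√t₀/2)` together with the
derivative formula
`(d/dR)Φ_{z₀}(R;Γ) = R⁵ ∫ |R^{−2}(x−x₀) ⌟ F_{t₀−R²} + 2(D*F)_{t₀−R²}|² G_{z₀}(·,t₀−R²)`. -/
theorem entropy_Phi_derivative_formula
    (n k : ℕ) (hn : 2 ≤ n) (hk : 1 ≤ k) (T : ℝ)
    (Γ : Conn n k) (hsm : IsSmoothConn Γ) (hflow : IsYMFlowOn Γ (Ico 0 T))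
    (K : Set (Fin n → ℝ)) (hK : IsCompact K) (hsupp : SuppIn Γ K)
    (x0 : Fin n → ℝ) (t0 : ℝ) (ht0 : t0 ∈ Ioo 0 T) :
    ∀ R ∈ Ioo 0 (Real.sqrt t0 / 2),
      HasDerivAt (fun r => Phi Γ (x0, t0) r)
        (R ^ 5 * ∫ x : Fin n → ℝ,
          (∑ j, msq ((R ^ 2)⁻¹ • (∑ i, (x i - x0 i) • curv Γ (t0 - R ^ 2) x i j)
              + (2 : ℝ) • dstarF Γ (t0 - R ^ 2) x j))
            * gauss (x0, t0) x (t0 - R ^ 2)) R := by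
  intro R hR
  obtain ⟨ht0, ht0T⟩ := ht0
  have hR0 : 0 < R := hR.1
  have hR2 : R ^ 2 < t0 := by
    have h1 := Real.sq_sqrt ht0.le
    have h2 := hR.2
    nlinarith
  have htT : t0 - R ^ 2 ∈ Ico 0 T := ⟨by linarith, by nlinarith⟩
  have hE := hasDerivAt_weighted_energy hsm hflow hK hsupp x0 htT
    (sub_lt_self t0 (pow_pos hR0 2))
  have hτ : HasDerivAt (fun r : ℝ => t0 - r ^ 2) (-(2 * R)) R := by
    simpa using ((hasDerivAt_id R).fun_pow 2).const_sub t0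
  have hR4 : HasDerivAt (fun r : ℝ => r ^ 4 / 2) (4 * R ^ 3 / 2) R := by
    simpa using ((hasDerivAt_id R).fun_pow 4).div_const 2
  refine (hR4.mul (hE.comp R hτ)).congr_deriv ?_
  simp only [sub_sub_cancel, Function.comp_apply]
  field_simp
  ring

end
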